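/- arXiv:1903.00845 — 3 statements merged into one kernel-verified Lean document; each statement's English description precedes it below -/
import Mathlib

section
/- There exist constants 0 < c ≤ C such that for every i ≥ 1, c·φ^{−2(a_{i+1}−a_i)} ≤ ‖R_i − L‖_F ≤ C·φ^{−2(a_{i+1}−a_i)}. In particular, R_i converges entrywise to L as i → ∞. -/
open Filter Finset Matrix

/-- The golden ratio φ = (1+√5)/2. -/
noncomputable def goldphi : ℝ := (1 + Real.sqrt 5) / 2

/-- The matrix `A`: identity in rows 1–7, row 8 = (0,0,0,0,0,1,1,1,1),
row 9 = (0,0,0,1,1,2,0,1,2). -/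
def Amat : Matrix (Fin 9) (Fin 9) ℝ :=
  !![1,0,0,0,0,0,0,0,0;
     0,1,0,0,0,0,0,0,0;
     0,0,1,0,0,0,0,0,0;
     0,0,0,1,0,0,0,0,0;
     0,0,0,0,1,0,0,0,0;
     0,0,0,0,0,1,0,0,0;
     0,0,0,0,0,0,1,0,0;
     0,0,0,0,0,1,1,1,1;
     0,0,0,1,1,2,0,1,2]

/-- The matrix `M` with rows e₆, e₉, e₈, e₂, e₄+e₅, e₇, e₁+e₃, e₃, e₄. -/
def Mmat : Matrix (Fin 9) (Fin 9) ℝ :=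
  !![0,0,0,0,0,1,0,0,0;
     0,0,0,0,0,0,0,0,1;
     0,0,0,0,0,0,0,1,0;
     0,1,0,0,0,0,0,0,0;
     0,0,0,1,1,0,0,0,0;
     0,0,0,0,0,0,1,0,0;
     1,0,1,0,0,0,0,0,0;
     0,0,1,0,0,0,0,0,0;
     0,0,0,1,0,0,0,0,0]

/-- The rank-one limit matrix `L`, nonzero only in rows 2 and 3. -/
noncomputable def Lmat : Matrix (Fin 9) (Fin 9) ℝ :=
  !![0,0,0,0,0,0,0,0,0;
     (Real.sqrt 5 - 1)/4, 1/2, (1 + Real.sqrt 5)/4, (3 + Real.sqrt 5)/4, 1/2, 0, (3 + Real.sqrt 5)/4, 0, 0;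
     (3 - Real.sqrt 5)/4, (Real.sqrt 5 - 1)/4, 1/2, (1 + Real.sqrt 5)/4, (Real.sqrt 5 - 1)/4, 0, (1 + Real.sqrt 5)/4, 0, 0;
     0,0,0,0,0,0,0,0,0;
     0,0,0,0,0,0,0,0,0;
     0,0,0,0,0,0,0,0,0;
     0,0,0,0,0,0,0,0,0;
     0,0,0,0,0,0,0,0,0;
     0,0,0,0,0,0,0,0,0]

/-- `a_i = r_i - 1`. -/
def aseq (r : ℕ → ℕ) (i : ℕ) : ℕ := r i - 1

/-- `c_i = (2/√5)·φ^{2 a_i}`. -/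
noncomputable def cseq (r : ℕ → ℕ) (i : ℕ) : ℝ :=
  (2 / Real.sqrt 5) * goldphi ^ (2 * aseq r i)

/-- `P_i = A^{a_i} M A^{a_{i+1}} M`. -/
noncomputable def Pmat (r : ℕ → ℕ) (i : ℕ) : Matrix (Fin 9) (Fin 9) ℝ :=
  Amat ^ (aseq r i) * Mmat * Amat ^ (aseq r (i+1)) * Mmat

/-- `R_i = P_i / c_{i+1}`. -/
noncomputable def Rmat (r : ℕ → ℕ) (i : ℕ) : Matrix (Fin 9) (Fin 9) ℝ :=
  (cseq r (i+1))⁻¹ • Pmat r i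

/-- The Frobenius norm of a square real matrix. -/
noncomputable def frobNorm {n : ℕ} (X : Matrix (Fin n) (Fin n) ℝ) : ℝ :=
  Real.sqrt (∑ i, ∑ j, (X i j)^2)

/-- The hypotheses on the sequence `r`: `r 1 = 1`, `r 2 = 2`, and the sequence of
differences `n ↦ r (n+1) - r n` (for `n ≥ 1`) is strictly increasing. -/
def GoodSeq (r : ℕ → ℕ) : Prop :=
  r 1 = 1 ∧ r 2 = 2 ∧ ∀ n, 1 ≤ n → r (n+1) - r n < r (n+2) - r (n+1)


/-- Closed form shape of the powers of `A`. -/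
def Eform (x y : ℝ) : Matrix (Fin 9) (Fin 9) ℝ :=
  !![1,0,0,0,0,0,0,0,0;
     0,1,0,0,0,0,0,0,0;
     0,0,1,0,0,0,0,0,0;
     0,0,0,1,0,0,0,0,0;
     0,0,0,0,1,0,0,0,0;
     0,0,0,0,0,1,0,0,0;
     0,0,0,0,0,0,1,0,0;
     0,0,0,x-1,x-1,x+y-1,y-x+1,x,y;
     0,0,0,y,y,x-1+2*y,x-1,y,x+y]

/-- Closed form of `M A^b M`. -/
def Qform (X Y : ℝ) : Matrix (Fin 9) (Fin 9) ℝ :=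
  !![0,0,0,0,0,0,1,0,0;
     X-1,Y,X+Y-1,X+2*Y,Y,0,X+2*Y-1,0,0;
     Y-X+1,X-1,Y+1,X+Y-1,X-1,0,X+Y-1,0,0;
     0,0,0,0,0,0,0,0,1;
     0,1,0,1,1,0,0,0,0;
     1,0,1,0,0,0,0,0,0;
     0,0,0,0,0,1,0,1,0;
     0,0,0,0,0,0,0,1,0;
     0,1,0,0,0,0,0,0,0]

/-- Closed form of `A^a M A^b M`. -/
def Pform (x y X Y : ℝ) : Matrix (Fin 9) (Fin 9) ℝ :=
  !![0,0,0,0,0,0,1,0,0;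
     X-1,Y,X+Y-1,X+2*Y,Y,0,X+2*Y-1,0,0;
     Y-X+1,X-1,Y+1,X+Y-1,X-1,0,X+Y-1,0,0;
     0,0,0,0,0,0,0,0,1;
     0,1,0,1,1,0,0,0,0;
     1,0,1,0,0,0,0,0,0;
     0,0,0,0,0,1,0,1,0;
     x+y-1,x+y-1,x+y-1,x-1,x-1,y-x+1,0,y+1,x-1;
     x+2*y-1,x+2*y,x+2*y-1,y,y,x-1,0,x+y-1,y]

/-- The matrix `2 w L` with `p = w (√5-1)/2`. -/
def Lform (p w : ℝ) : Matrix (Fin 9) (Fin 9) ℝ :=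
  !![0,0,0,0,0,0,0,0,0;
     p,w,p+w,p+2*w,w,0,p+2*w,0,0;
     w-p,p,w,p+w,p,0,p+w,0,0;
     0,0,0,0,0,0,0,0,0;
     0,0,0,0,0,0,0,0,0;
     0,0,0,0,0,0,0,0,0;
     0,0,0,0,0,0,0,0,0;
     0,0,0,0,0,0,0,0,0;
     0,0,0,0,0,0,0,0,0]

lemma Eform_zero : Eform 1 0 = 1 := by
  ext i j
  fin_cases i <;> fin_cases j <;> simp [Eform, Matrix.one_apply]

set_option maxHeartbeats 4000000 in
lemma Eform_mul (x y : ℝ) : Eform x y * Amat = Eform (x + y) (x + 2 * y) := by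
  ext i j
  fin_cases i <;> fin_cases j <;>
    (simp [Eform, Amat, Matrix.mul_apply, Fin.sum_univ_succ] <;> try ring)

set_option maxHeartbeats 4000000 in
lemma Qform_eq (X Y : ℝ) : Mmat * (Eform X Y * Mmat) = Qform X Y := by
  ext i j
  fin_cases i <;> fin_cases j <;>
    (simp [Eform, Mmat, Qform, Matrix.mul_apply, Fin.sum_univ_succ] <;> try ring)

set_option maxHeartbeats 4000000 in
lemma Pform_eq (x y X Y : ℝ) : Eform x y * Qform X Y = Pform x y X Y := by
  ext i j
  fin_cases i <;> fin_cases j <;>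
    (simp [Eform, Pform, Qform, Matrix.mul_apply, Fin.sum_univ_succ] <;> try ring)

lemma Apow (n : ℕ) : ∃ x y v : ℝ, Amat ^ n = Eform x y ∧ 0 ≤ v ∧ v ≤ 1 ∧
    Real.sqrt 5 * y = goldphi ^ (2 * n) - v ∧
    Real.sqrt 5 * x = (Real.sqrt 5 - 1) / 2 * goldphi ^ (2 * n) + (Real.sqrt 5 + 1) / 2 * v := by
  have h5 : Real.sqrt 5 * Real.sqrt 5 = 5 := Real.mul_self_sqrt (by norm_num)
  have hs0 : 0 ≤ Real.sqrt 5 := Real.sqrt_nonneg 5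
  have hs2 : 2 < Real.sqrt 5 := by nlinarith
  have hs3 : Real.sqrt 5 < 3 := by nlinarith
  induction n with
  | zero => exact ⟨1, 0, 1, by simp [Eform_zero], by norm_num, le_refl _, by simp, by simp; ring⟩
  | succ n ih =>
    obtain ⟨x, y, v, hA, hv0, hv1, hy, hx⟩ := ih
    have hg : goldphi ^ (2 * (n + 1)) = goldphi ^ (2 * n) * ((3 + Real.sqrt 5) / 2) := by
      have : goldphi ^ 2 = (3 + Real.sqrt 5) / 2 := by
        unfold goldphi; linear_combination h5 / 4
      rw [← this]; ring
    refine ⟨x + y, x + 2 * y, v * ((3 - Real.sqrt 5) / 2), ?_, ?_, ?_, ?_, ?_⟩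
    · rw [pow_succ, hA, Eform_mul]
    · apply mul_nonneg hv0; linarith
    · nlinarith
    · rw [hg]; linear_combination hx + 2 * hy
    · rw [hg]
      linear_combination hx + hy + (v - goldphi ^ (2 * n)) / 4 * h5

lemma Lform_eq (w : ℝ) :
    Lform ((Real.sqrt 5 - 1) / 2 * w) w = (2 * w) • Lmat := by
  ext i j
  fin_cases i <;> fin_cases j <;> (simp [Lform, Lmat] <;> try ring)

set_option maxHeartbeats 4000000 in
lemma entry_bound (x y X Y p w u : ℝ) (hx0 : 0 ≤ x) (hx : x ≤ u) (hy0 : 0 ≤ y) (hy : y ≤ u)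
    (hu : 1 ≤ u) (h1 : X - p ≤ 1) (h2 : p - X ≤ 1) (h3 : Y - w ≤ 1) (h4 : w - Y ≤ 1)
    (i j : Fin 9) : |Pform x y X Y i j - Lform p w i j| ≤ 4 * u := by
  rw [abs_le]
  fin_cases i <;> fin_cases j <;> (simp [Pform, Lform] <;> (try constructor) <;> linarith)

lemma gold_one_le : 1 < goldphi := by
  have h5 : Real.sqrt 5 * Real.sqrt 5 = 5 := Real.mul_self_sqrt (by norm_num)
  have hs0 : 0 ≤ Real.sqrt 5 := Real.sqrt_nonneg 5
  unfold goldphi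
  nlinarith

lemma gold_zpow (a b : ℕ) :
    goldphi ^ ((-2 : ℤ) * ((b : ℤ) - (a : ℤ))) = goldphi ^ (2 * a) / goldphi ^ (2 * b) := by
  have h0 : goldphi ≠ 0 := by linarith [gold_one_le]
  rw [show (-2 : ℤ) * ((b : ℤ) - (a : ℤ)) = ((2 * a : ℕ) : ℤ) - ((2 * b : ℕ) : ℤ) by
    push_cast; ring, zpow_sub₀ h0, zpow_natCast, zpow_natCast]

lemma key (r : ℕ → ℕ) (i : ℕ) :
    (∀ j k, |(Rmat r i - Lmat) j k| ≤
      6 * goldphi ^ ((-2 : ℤ) * ((aseq r (i+1) : ℤ) - (aseq r i : ℤ)))) ∧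
    1 / 2 * goldphi ^ ((-2 : ℤ) * ((aseq r (i+1) : ℤ) - (aseq r i : ℤ))) ≤
      (Rmat r i - Lmat) 8 1 := by
  have h5 : Real.sqrt 5 * Real.sqrt 5 = 5 := Real.mul_self_sqrt (by norm_num)
  have hs0 : 0 ≤ Real.sqrt 5 := Real.sqrt_nonneg 5
  have hs2 : 2 < Real.sqrt 5 := by nlinarith
  have hs3 : Real.sqrt 5 < 3 := by nlinarith
  rw [gold_zpow]
  obtain ⟨x, y, v, hA, hv0, hv1, hy, hx⟩ := Apow (aseq r i)
  obtain ⟨X, Y, V, hB, hV0, hV1, hY, hX⟩ := Apow (aseq r (i+1))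
  have hu : 1 ≤ goldphi ^ (2 * aseq r i) := one_le_pow₀ gold_one_le.le
  have hU : 1 ≤ goldphi ^ (2 * aseq r (i+1)) := one_le_pow₀ gold_one_le.le
  have hc : cseq r (i+1) = 2 * (goldphi ^ (2 * aseq r (i+1)) / Real.sqrt 5) := by
    unfold cseq; ring
  have hP : Pmat r i = Pform x y X Y := by
    unfold Pmat
    rw [hA, hB, mul_assoc, mul_assoc, Qform_eq, Pform_eq]
  generalize goldphi ^ (2 * aseq r i) = u at *
  generalize goldphi ^ (2 * aseq r (i+1)) = U at *
  obtain ⟨w, hw⟩ : ∃ w, w = U / Real.sqrt 5 := ⟨_, rfl⟩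
  have hUw : U = Real.sqrt 5 * w := by rw [hw]; field_simp
  have hw0 : 0 < w := by rw [hw]; positivity
  rw [← hw] at hc
  have hRL : Rmat r i - Lmat =
      (2 * w)⁻¹ • (Pform x y X Y - Lform ((Real.sqrt 5 - 1) / 2 * w) w) := by
    rw [Lform_eq, smul_sub, smul_smul, inv_mul_cancel₀ (by positivity), one_smul, Rmat, hc, hP]
  have hx0 : 0 ≤ x := by
    by_contra h; push Not at h; nlinarith
  have hy0 : 0 ≤ y := by
    by_contra h; push Not at h; nlinarith
  have hxu : x ≤ u := by
    by_contra h; push Not at h; nlinarith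
  have hyu : y ≤ u := by
    by_contra h; push Not at h; nlinarith
  have e1 : Real.sqrt 5 * (X - (Real.sqrt 5 - 1) / 2 * w) = (Real.sqrt 5 + 1) / 2 * V := by
    rw [hUw] at hX; linear_combination hX
  have e2 : Real.sqrt 5 * (Y - w) = - V := by
    rw [hUw] at hY; linear_combination hY
  have hb := entry_bound x y X Y ((Real.sqrt 5 - 1) / 2 * w) w u hx0 hxu hy0 hyu hu
    (by by_contra h; push Not at h; nlinarith) (by by_contra h; push Not at h; nlinarith)
    (by by_contra h; push Not at h; nlinarith) (by by_contra h; push Not at h; nlinarith)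
  rw [hRL]
  constructor
  · intro j k
    rw [Matrix.smul_apply, smul_eq_mul, Matrix.sub_apply, abs_mul, abs_of_pos (by positivity),
      hUw]
    calc (2 * w)⁻¹ * |Pform x y X Y j k - Lform ((Real.sqrt 5 - 1) / 2 * w) w j k|
        ≤ (2 * w)⁻¹ * (4 * u) := by gcongr; exact hb j k
      _ ≤ 6 * (u / (Real.sqrt 5 * w)) := by
        have : (2 * w)⁻¹ * (4 * u) = (2 * Real.sqrt 5) * (u / (Real.sqrt 5 * w)) := by
          field_simp; norm_num
        rw [this]; gcongr; linarith
  · have h : (Pform x y X Y - Lform ((Real.sqrt 5 - 1) / 2 * w) w) 8 1 = x + 2 * y := by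
      simp [Pform, Lform]
    rw [Matrix.smul_apply, h, smul_eq_mul, hUw]
    have : 1 / 2 * (u / (Real.sqrt 5 * w)) = (2 * w)⁻¹ * (u / Real.sqrt 5) := by
      field_simp
    rw [this]
    gcongr
    rw [div_le_iff₀ (by positivity)]
    nlinarith

lemma diff_lower (r : ℕ → ℕ) (hr : GoodSeq r) (n : ℕ) :
    1 ≤ r (n+1) ∧ n + 1 ≤ r (n+2) - r (n+1) := by
  obtain ⟨h1, h2, h3⟩ := hr
  induction n with
  | zero => simp [h1, h2]
  | succ n ih =>
    have := h3 (n+1) (by omega)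
    simp only [add_assoc] at *
    norm_num at *
    omega

/-- `‖R_i − L‖_F ≍ φ^{−2(a_{i+1}−a_i)}` for `i ≥ 1`; in particular `R_i → L` entrywise. -/
theorem stmt1 (r : ℕ → ℕ) (hr : GoodSeq r) :
    (∃ c C : ℝ, 0 < c ∧ c ≤ C ∧ ∀ i : ℕ, 1 ≤ i →
      c * goldphi ^ ((-2 : ℤ) * ((aseq r (i+1) : ℤ) - (aseq r i : ℤ)))
          ≤ frobNorm (Rmat r i - Lmat) ∧
      frobNorm (Rmat r i - Lmat)
          ≤ C * goldphi ^ ((-2 : ℤ) * ((aseq r (i+1) : ℤ) - (aseq r i : ℤ)))) ∧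
    ∀ j k : Fin 9, Tendsto (fun i => Rmat r i j k) atTop (nhds (Lmat j k)) := by
  refine ⟨⟨1 / 2, 54, by norm_num, by norm_num, ?_⟩, ?_⟩
  · intro i _
    obtain ⟨hub, hlb⟩ := key r i
    have hg : 0 < goldphi ^ ((-2 : ℤ) * ((aseq r (i+1) : ℤ) - (aseq r i : ℤ))) :=
      zpow_pos (by linarith [gold_one_le]) _
    generalize goldphi ^ ((-2 : ℤ) * ((aseq r (i+1) : ℤ) - (aseq r i : ℤ))) = g at *
    generalize Rmat r i - Lmat = D at *
    unfold frobNorm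
    constructor
    · apply Real.le_sqrt_of_sq_le
      calc (1 / 2 * g) ^ 2 ≤ (D 8 1) ^ 2 := by gcongr
        _ ≤ ∑ j, (D 8 j) ^ 2 :=
          Finset.single_le_sum (f := fun j => (D 8 j) ^ 2) (fun j _ => sq_nonneg _)
            (Finset.mem_univ 1)
        _ ≤ ∑ i, ∑ j, (D i j) ^ 2 :=
          Finset.single_le_sum (f := fun i => ∑ j, (D i j) ^ 2)
            (fun i _ => Finset.sum_nonneg fun j _ => sq_nonneg _) (Finset.mem_univ 8)
    · apply Real.sqrt_le_iff.mpr
      refine ⟨by positivity, ?_⟩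
      calc ∑ i, ∑ j, (D i j) ^ 2 ≤ ∑ _i : Fin 9, ∑ _j : Fin 9, (6 * g) ^ 2 := by
            refine Finset.sum_le_sum fun i _ => Finset.sum_le_sum fun j _ => ?_
            exact sq_le_sq' (abs_le.mp (hub i j)).1 (abs_le.mp (hub i j)).2
        _ = (54 * g) ^ 2 := by simp; ring
  · intro j k
    rw [← tendsto_sub_nhds_zero_iff]
    have hg1 := gold_one_le
    have hlim : Tendsto (fun n : ℕ => 6 * (goldphi⁻¹) ^ n) atTop (nhds 0) := by
      simpa using (tendsto_pow_atTop_nhds_zero_of_lt_one (by positivity)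
        (inv_lt_one_of_one_lt₀ hg1)).const_mul (6 : ℝ)
    refine squeeze_zero_norm' ?_ hlim
    filter_upwards [eventually_ge_atTop 1] with i hi
    obtain ⟨n, rfl⟩ : ∃ n, i = n + 1 := ⟨i - 1, by omega⟩
    refine ((key r (n+1)).1 j k).trans ?_
    obtain ⟨h1, h2⟩ := diff_lower r hr n
    rw [inv_pow, ← zpow_natCast, ← _root_.zpow_neg]
    gcongr
    · exact hg1.le
    · unfold aseq
      rw [show n + 1 + 1 = n + 2 from rfl]
      push_cast
      omega
end

section
/- For every i ≥ 1, the products R_i·R_{i+2}·⋯·R_{i+2k} converge in Frobenius norm, as k → ∞, to a matrix which is nonzero. -/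
open Filter Finset Matrix

noncomputable def qq (n : ℕ) : ℝ := goldphi ^ (2 * n)
noncomputable def pp (n : ℕ) : ℝ := (2 - goldphi) ^ n
noncomputable def xx (n : ℕ) : ℝ := (qq n - pp n) / (2 * goldphi - 1)
noncomputable def yy (n : ℕ) : ℝ := (goldphi * qq n + (goldphi - 1) * pp n) / (2 * goldphi - 1)

lemma gold_sq : goldphi ^ 2 = goldphi + 1 := by
  have h : Real.sqrt 5 ^ 2 = 5 := Real.sq_sqrt (by norm_num)
  unfold goldphi; linear_combination h / 4

lemma sqrt_gold : Real.sqrt 5 = 2 * goldphi - 1 := by unfold goldphi; ring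

lemma gold_lb : (8/5 : ℝ) < goldphi := by
  have : (11/5 : ℝ) < Real.sqrt 5 := by
    apply Real.lt_sqrt_of_sq_lt; norm_num
  unfold goldphi; linarith

lemma gold_ub : goldphi < 17/10 := by
  have : Real.sqrt 5 < 12/5 := by
    rw [Real.sqrt_lt' (by norm_num)]; norm_num
  unfold goldphi; linarith

lemma qq_succ (n : ℕ) : qq (n+1) = (goldphi + 1) * qq n := by
  unfold qq; rw [← gold_sq]; ring
lemma pp_succ (n : ℕ) : pp (n+1) = (2 - goldphi) * pp n := by
  unfold pp; ring
lemma qp (n : ℕ) : qq n * pp n = 1 := by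
  induction n with
  | zero => simp [qq, pp]
  | succ n ih =>
    rw [qq_succ, pp_succ]
    have := gold_sq
    linear_combination ih + (-1) * (qq n * pp n) * this
lemma pp_pos (n : ℕ) : 0 < pp n := pow_pos (by linarith [gold_ub]) _
lemma pp_le_one (n : ℕ) : pp n ≤ 1 := pow_le_one₀ (by linarith [gold_ub]) (by linarith [gold_lb])
lemma qq_pos (n : ℕ) : 0 < qq n := pow_pos (by linarith [gold_lb]) _
lemma pp_anti {m n : ℕ} (h : m ≤ n) : pp n ≤ pp m :=
  pow_le_pow_of_le_one (by linarith [gold_ub]) (by linarith [gold_lb]) h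
lemma pp_le (n : ℕ) : pp n ≤ (2/5 : ℝ) ^ n :=
  pow_le_pow_left₀ (by linarith [gold_ub]) (by linarith [gold_lb]) _

lemma xx_succ (n : ℕ) : xx (n+1) = xx n + yy n := by
  unfold xx yy; rw [qq_succ, pp_succ]; ring
lemma yy_succ (n : ℕ) : yy (n+1) = xx n + 2 * yy n := by
  have := gold_sq
  unfold xx yy; rw [qq_succ, pp_succ]
  linear_combination (qq n - pp n) / (2 * goldphi - 1) * this

/-- closed form of powers of `A`. -/
def Aexp (x y : ℝ) : Matrix (Fin 9) (Fin 9) ℝ :=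
  !![1,0,0,0,0,0,0,0,0;
     0,1,0,0,0,0,0,0,0;
     0,0,1,0,0,0,0,0,0;
     0,0,0,1,0,0,0,0,0;
     0,0,0,0,1,0,0,0,0;
     0,0,0,0,0,1,0,0,0;
     0,0,0,0,0,0,1,0,0;
     0,0,0,y-x-1,y-x-1,y-1,2*x-y+1,y-x,x;
     0,0,0,x,x,y+x-1,y-x-1,x,y]

set_option maxHeartbeats 2000000 in
lemma Aexp_mul (x y : ℝ) : Amat * Aexp x y = Aexp (x+y) (x+2*y) := by
  ext i j
  fin_cases i <;> fin_cases j <;>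
    simp [Amat, Aexp, Matrix.mul_apply, Fin.sum_univ_succ] <;> ring

lemma Aexp_zero : Aexp 0 1 = 1 := by
  ext i j
  fin_cases i <;> fin_cases j <;> simp [Aexp]

lemma Apow_s3 (n : ℕ) : Amat ^ n = Aexp (xx n) (yy n) := by
  induction n with
  | zero =>
    have h : 2 * goldphi - 1 ≠ 0 := by have := gold_lb; intro h; linarith
    have h1 : xx 0 = 0 := by simp [xx, qq, pp]
    have h2 : yy 0 = 1 := by simp only [yy, qq, pp]; rw [div_eq_iff h]; simp; ring
    rw [h1, h2, Aexp_zero, pow_zero]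
  | succ n ih => rw [pow_succ', ih, Aexp_mul, xx_succ, yy_succ]

set_option maxHeartbeats 2000000 in
lemma Aexp_lin (x y : ℝ) : Aexp x y = Aexp 0 0 + x • (Aexp 1 0 - Aexp 0 0)
    + y • (Aexp 0 1 - Aexp 0 0) := by
  ext i j
  fin_cases i <;> fin_cases j <;> simp [Aexp] <;> ring

def Bexp (x y : ℝ) : Matrix (Fin 9) (Fin 9) ℝ := Mmat * Aexp x y * Mmat

set_option maxHeartbeats 2000000 in
/-- explicit form of `M A^n M`. -/
lemma Bexp_eq (x y : ℝ) : Bexp x y =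
  !![0,0,0,0,0,0,1,0,0;
     y-x-1,x,y-1,x+y,x,0,x+y-1,0,0;
     2*x-y+1,y-x-1,x+1,y-1,y-x-1,0,y-1,0,0;
     0,0,0,0,0,0,0,0,1;
     0,1,0,1,1,0,0,0,0;
     1,0,1,0,0,0,0,0,0;
     0,0,0,0,0,1,0,1,0;
     0,0,0,0,0,0,0,1,0;
     0,1,0,0,0,0,0,0,0] := by
  ext i j
  fin_cases i <;> fin_cases j <;>
    simp [Bexp, Aexp, Mmat, Matrix.mul_apply, Fin.sum_univ_succ] <;> ring

/-- Convergence of products of perturbations of an idempotent. -/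
lemma prod_conv {E : Type*} [NormedRing E] [CompleteSpace E] (L : E) (hL : L * L = L)
    (R : ℕ → E) (C θ : ℝ) (hC : 0 ≤ C) (h0 : 0 ≤ θ) (h1 : θ < 1)
    (hR : ∀ l, ‖R l - L‖ ≤ C * θ ^ l) (X : ℕ → E) (hX : ∀ k, X (k+1) = X k * R k) :
    ∃ S, Tendsto X atTop (nhds S) := by
  set m : ℝ := ‖L‖ + 1 with hm
  have hm1 : 1 ≤ m := by have := norm_nonneg L; linarith
  have hsum : Summable (fun l => m * C * θ ^ l) :=
    (summable_geometric_of_lt_one h0 h1).mul_left _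
  set B0 : ℝ := ‖X 0‖ + ‖X 0 * L‖ with hB0
  have hB0n : 0 ≤ B0 := by positivity
  have key : ∀ k, ‖X k‖ ≤ B0 * Real.exp (∑ l ∈ Finset.range k, m * C * θ ^ l) ∧
      ‖X k * L‖ ≤ B0 * Real.exp (∑ l ∈ Finset.range k, m * C * θ ^ l) := by
    intro k
    induction k with
    | zero =>
      simp only [Finset.range_zero, Finset.sum_empty, Real.exp_zero, mul_one]
      exact ⟨by simp [hB0], by simp [hB0]⟩
    | succ k ih =>
      rw [Finset.sum_range_succ, Real.exp_add, ← mul_assoc]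
      set B := B0 * Real.exp (∑ l ∈ Finset.range k, m * C * θ ^ l) with hB
      have hBn : 0 ≤ B := by positivity
      set e := C * θ ^ k with he
      have hen : 0 ≤ e := by positivity
      have hexp : 1 + m * e ≤ Real.exp (m * C * θ ^ k) := by
        have := Real.add_one_le_exp (m * C * θ ^ k)
        rw [he]; linarith [mul_assoc m C (θ ^ k)]
      have hb : B * (1 + m * e) ≤ B * Real.exp (m * C * θ ^ k) := by gcongr
      have hE : ‖X k * (R k - L)‖ ≤ B * e :=
        (norm_mul_le _ _).trans (by gcongr; exact ih.1; exact hR k)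
      have hEL : ‖X k * (R k - L) * L‖ ≤ B * e * m :=
        (norm_mul_le _ _).trans (by gcongr; linarith)
      have e1 : X (k+1) = X k * L + X k * (R k - L) := by rw [hX]; noncomm_ring
      have e2 : X (k+1) * L = X k * L + X k * (R k - L) * L := by
        rw [e1, add_mul, mul_assoc, hL]
      have hBe : 0 ≤ B * e := by positivity
      constructor
      · rw [e1]
        have := norm_add_le (X k * L) (X k * (R k - L))
        nlinarith [ih.2]
      · rw [e2]
        have := norm_add_le (X k * L) (X k * (R k - L) * L)
        nlinarith [ih.2]
  set B := B0 * Real.exp (∑' l, m * C * θ ^ l) with hB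
  have hBn : 0 ≤ B := by positivity
  have hXB : ∀ k, ‖X k‖ ≤ B := fun k => (key k).1.trans (by
    rw [hB]; gcongr
    exact hsum.sum_le_tsum _ (fun _ _ => by positivity))
  have hE : ∀ k, ‖X k * (R k - L)‖ ≤ (B * C) * θ ^ k := fun k =>
    (norm_mul_le _ _).trans (by rw [mul_assoc]; gcongr; exact hXB k; exact hR k)
  have e1 : ∀ k, X (k+1) = X k * L + X k * (R k - L) := by intro k; rw [hX]; noncomm_ring
  have hY : CauchySeq (fun k => X k * L) := by
    apply cauchySeq_of_le_geometric θ (B * C * m) h1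
    intro k
    rw [dist_eq_norm, e1 k, add_mul, mul_assoc (X k) L L, hL, sub_add_cancel_left, norm_neg]
    calc _ ≤ ‖X k * (R k - L)‖ * ‖L‖ := norm_mul_le _ _
      _ ≤ (B * C * θ ^ k) * m := by gcongr; exact hE k; linarith
      _ = _ := by ring
  obtain ⟨S, hS⟩ := cauchySeq_tendsto_of_complete hY
  refine ⟨S, ?_⟩
  have hz : Tendsto (fun k => X k * (R k - L)) atTop (nhds 0) := by
    apply squeeze_zero_norm hE
    simpa using (tendsto_pow_atTop_nhds_zero_of_lt_one h0 h1).const_mul (B * C)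
  have := hS.add hz
  rw [add_zero] at this
  rw [← tendsto_add_atTop_iff_nat 1]
  exact this.congr (fun k => (e1 k).symm)

attribute [local instance] Matrix.frobeniusNormedRing Matrix.frobeniusNormedSpace

lemma rr_facts (r : ℕ → ℕ) (hr : GoodSeq r) (n : ℕ) :
    n ≤ aseq r (n+1) ∧ aseq r (n+1) + (n+1) ≤ aseq r (n+2) := by
  obtain ⟨h1, h2, h3⟩ := hr
  have hd : ∀ n, n + 1 ≤ r (n+2) - r (n+1) := by
    intro n
    induction n with
    | zero => simp [h1, h2]
    | succ n ih => 
      have h := h3 (n+1) (by omega)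
      have e1 : n + 1 + 1 = n + 2 := rfl
      have e2 : n + 1 + 2 = n + 3 := rfl
      rw [e1, e2] at *
      omega
  have hr1 : ∀ n, n + 1 ≤ r (n+1) := by
    intro n
    induction n with
    | zero => simp [h1]
    | succ n ih => 
      have := hd n
      have e1 : n + 1 + 1 = n + 2 := rfl
      rw [e1] at *
      omega
  have := hd n
  have := hr1 n
  unfold aseq
  omega

set_option maxHeartbeats 2000000 in
lemma L_eq : (Bexp 1 0 - Bexp 0 0) + goldphi • (Bexp 0 1 - Bexp 0 0) = (2:ℝ) • Lmat := by
  simp only [Bexp_eq]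
  unfold Lmat
  rw [sqrt_gold]
  ext i j
  fin_cases i <;> fin_cases j <;> simp <;> ring

set_option maxHeartbeats 2000000 in
lemma L_idem : Lmat * Lmat = Lmat := by
  have h := gold_sq
  unfold Lmat
  rw [sqrt_gold]
  ext i j
  fin_cases i <;> fin_cases j <;> simp [Matrix.mul_apply, Fin.sum_univ_succ] <;> grind

set_option maxHeartbeats 2000000 in
lemma AL : Amat * Lmat = Lmat := by
  ext i j
  fin_cases i <;> fin_cases j <;> simp [Amat, Lmat, Matrix.mul_apply, Fin.sum_univ_succ]

lemma ApowL (n : ℕ) : Amat ^ n * Lmat = Lmat := by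
  induction n with
  | zero => simp
  | succ n ih => rw [pow_succ, mul_assoc, AL, ih]

lemma Bexp_lin (x y : ℝ) : Bexp x y = Bexp 0 0 + x • (Bexp 1 0 - Bexp 0 0)
    + y • (Bexp 0 1 - Bexp 0 0) := by
  unfold Bexp
  conv_lhs => rw [Aexp_lin]
  simp only [mul_add, add_mul, mul_sub, sub_mul, Matrix.mul_smul, Matrix.smul_mul]

lemma Bn_eq (n : ℕ) : Mmat * Amat ^ n * Mmat - (2 / Real.sqrt 5 * goldphi ^ (2 * n)) • Lmat
    = Bexp 0 0 + (pp n / (2 * goldphi - 1)) • (- (Bexp 1 0 - Bexp 0 0)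
      + (goldphi - 1) • (Bexp 0 1 - Bexp 0 0)) := by
  have h : (2 / Real.sqrt 5 * goldphi ^ (2 * n)) • Lmat =
      (qq n / (2 * goldphi - 1)) • ((2:ℝ) • Lmat) := by
    rw [smul_smul, sqrt_gold, qq]; congr 1; ring
  have h' : Mmat * Amat ^ n * Mmat = Bexp (xx n) (yy n) := by rw [Apow_s3, Bexp]
  rw [h, h', Bexp_lin, ← L_eq, xx, yy]
  module

lemma Bn_bound : ∃ K : ℝ, 0 ≤ K ∧ ∀ n,
    ‖Mmat * Amat ^ n * Mmat - (2 / Real.sqrt 5 * goldphi ^ (2 * n)) • Lmat‖ ≤ K := by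
  refine ⟨‖Bexp 0 0‖ + ‖(- (Bexp 1 0 - Bexp 0 0)
      + (goldphi - 1) • (Bexp 0 1 - Bexp 0 0))‖, by positivity, fun n => ?_⟩
  rw [Bn_eq]
  refine (norm_add_le _ _).trans ?_
  gcongr
  rw [norm_smul]
  apply mul_le_of_le_one_left (norm_nonneg _)
  have h1 := gold_lb
  have h2 := pp_le_one n
  have h3 := pp_pos n
  rw [Real.norm_of_nonneg (div_nonneg h3.le (by linarith)), div_le_one (by linarith)]
  linarith

lemma qq_ge_one (n : ℕ) : 1 ≤ qq n := one_le_pow₀ (by linarith [gold_lb])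

lemma A_bound : ∃ K : ℝ, 0 ≤ K ∧ ∀ n, ‖Amat ^ n‖ ≤ K * qq n := by
  refine ⟨‖Aexp 0 0‖ + ‖Aexp 1 0 - Aexp 0 0‖ + 2 * ‖Aexp 0 1 - Aexp 0 0‖,
    by positivity, fun n => ?_⟩
  have h1 := gold_lb
  have h4 := gold_ub
  have h2 := pp_le_one n
  have h3 := pp_pos n
  have hq := qq_ge_one n
  have hs : 0 < 2 * goldphi - 1 := by linarith
  have hx0 : 0 ≤ xx n := div_nonneg (by linarith) hs.le
  have hx : xx n ≤ qq n := by
    rw [xx, div_le_iff₀ hs]; nlinarith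
  have hy0 : 0 ≤ yy n := div_nonneg (by nlinarith) hs.le
  have hy : yy n ≤ 2 * qq n := by
    rw [yy, div_le_iff₀ hs]; nlinarith
  rw [Apow_s3, Aexp_lin, add_mul, add_mul]
  refine (norm_add₃_le).trans ?_
  rw [norm_smul, norm_smul, Real.norm_of_nonneg hx0, Real.norm_of_nonneg hy0]
  gcongr ?_ + ?_ + ?_
  · exact le_mul_of_one_le_right (norm_nonneg _) hq
  · rw [mul_comm]; gcongr
  · calc _ ≤ (2 * qq n) * ‖Aexp 0 1 - Aexp 0 0‖ := by gcongr
      _ = _ := by ring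

lemma cseq_eq (r : ℕ → ℕ) (i : ℕ) : cseq r i = 2 * qq (aseq r i) / (2 * goldphi - 1) := by
  rw [cseq, sqrt_gold, qq]; ring

lemma cseq_pos (r : ℕ → ℕ) (i : ℕ) : 0 < cseq r i := by
  rw [cseq_eq]
  exact div_pos (by linarith [qq_pos (aseq r i)]) (by linarith [gold_lb])

lemma R_bound (r : ℕ → ℕ) : ∃ K : ℝ, 0 ≤ K ∧ ∀ i,
    ‖Rmat r i - Lmat‖ ≤ K * (qq (aseq r i) * pp (aseq r (i+1))) := by
  obtain ⟨K1, hK1, h1⟩ := A_bound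
  obtain ⟨K2, hK2, h2⟩ := Bn_bound
  refine ⟨K1 * K2 * 2, by positivity, fun i => ?_⟩
  have hc := cseq_pos r (i+1)
  have e : Rmat r i - Lmat = (cseq r (i+1))⁻¹ • (Amat ^ (aseq r i) *
      (Mmat * Amat ^ (aseq r (i+1)) * Mmat
        - (2 / Real.sqrt 5 * goldphi ^ (2 * aseq r (i+1))) • Lmat)) := by
    rw [mul_sub, Matrix.mul_smul, ApowL, smul_sub, smul_smul, ← cseq, inv_mul_cancel₀ hc.ne',
      one_smul, Rmat, Pmat]
    simp only [mul_assoc]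
  have hci : (cseq r (i+1))⁻¹ ≤ 2 * pp (aseq r (i+1)) := by
    rw [inv_le_iff_one_le_mul₀ hc, cseq_eq]
    have hs : 0 < 2 * goldphi - 1 := by linarith [gold_lb]
    rw [mul_div_assoc', le_div_iff₀ hs]
    linarith [qp (aseq r (i+1)), gold_ub]
  rw [e, norm_smul, Real.norm_of_nonneg (inv_nonneg.2 hc.le)]
  have hp := pp_pos (aseq r (i+1))
  have hq := qq_pos (aseq r i)
  calc _ ≤ (2 * pp (aseq r (i+1))) * ((K1 * qq (aseq r i)) * K2) := by
        gcongr
        refine (norm_mul_le _ _).trans ?_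
        gcongr
        · exact h1 _
        · exact h2 _
    _ = _ := by ring

lemma A_nonneg (i j : Fin 9) : 0 ≤ Amat i j := by
  fin_cases i <;> fin_cases j <;> simp [Amat]
lemma M_nonneg (i j : Fin 9) : 0 ≤ Mmat i j := by
  fin_cases i <;> fin_cases j <;> simp [Mmat]
lemma mul_nn {X Y : Matrix (Fin 9) (Fin 9) ℝ} (hX : ∀ i j, 0 ≤ X i j) (hY : ∀ i j, 0 ≤ Y i j) :
    ∀ i j, 0 ≤ (X * Y) i j := fun i j => by
  rw [Matrix.mul_apply]; exact Finset.sum_nonneg (fun k _ => mul_nonneg (hX _ _) (hY _ _))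
lemma one_nn : ∀ i j, 0 ≤ (1 : Matrix (Fin 9) (Fin 9) ℝ) i j := fun i j => by
  rw [Matrix.one_apply]; split_ifs <;> norm_num
lemma Apow_nn (n : ℕ) : ∀ i j, 0 ≤ (Amat ^ n) i j := by
  induction n with
  | zero => rw [pow_zero]; exact one_nn
  | succ n ih => rw [pow_succ]; exact mul_nn ih A_nonneg
lemma R_nn (r : ℕ → ℕ) (i : ℕ) : ∀ a b, 0 ≤ Rmat r i a b := fun a b => by
  rw [Rmat, Matrix.smul_apply, smul_eq_mul]
  exact mul_nonneg (inv_nonneg.2 (cseq_pos r _).le)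
    (mul_nn (mul_nn (mul_nn (Apow_nn _) M_nonneg) (Apow_nn _)) M_nonneg a b)

noncomputable def wvec : Fin 9 → ℝ := ![0, goldphi, 1, 0, 0, 0, 0, 0, 0]

lemma w_nn (a : Fin 9) : 0 ≤ wvec a := by
  have := gold_lb
  fin_cases a <;> simp [wvec]; linarith

lemma Rw (r : ℕ → ℕ) (i : ℕ) (a : Fin 9) :
    (1 - pp (aseq r (i+1))) * wvec a ≤ (Rmat r i *ᵥ wvec) a := by
  have hc := cseq_pos r (i+1)
  have hnn : 0 ≤ (Rmat r i *ᵥ wvec) a := by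
    simp only [Matrix.mulVec, dotProduct]
    exact Finset.sum_nonneg (fun k _ => mul_nonneg (R_nn r i a k) (w_nn k))
  have e : Rmat r i *ᵥ wvec = (cseq r (i+1))⁻¹ • (Aexp (xx (aseq r i)) (yy (aseq r i)) *ᵥ
      (Bexp (xx (aseq r (i+1))) (yy (aseq r (i+1))) *ᵥ wvec)) := by
    rw [Rmat, Pmat, Matrix.smul_mulVec, Bexp, ← Apow_s3, ← Apow_s3, Matrix.mulVec_mulVec]
    simp only [mul_assoc]
  rw [e] at hnn ⊢
  have hs : 0 < 2 * goldphi - 1 := by linarith [gold_lb]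
  have hp1 := pp_le_one (aseq r (i+1))
  have hp0 := pp_pos (aseq r (i+1))
  have hqp := qp (aseq r (i+1))
  have hsq := gold_sq
  have hl := gold_lb
  have hu := gold_ub
  have hcc := cseq_eq r (i+1)
  generalize aseq r (i+1) = n at *
  have hx : xx n * (2 * goldphi - 1) = qq n - pp n := by rw [xx, div_mul_cancel₀ _ hs.ne']
  have hy : yy n * (2 * goldphi - 1) = goldphi * qq n + (goldphi - 1) * pp n := by
    rw [yy, div_mul_cancel₀ _ hs.ne']
  have row2 : (1 - pp n) * goldphi * cseq r (i+1) ≤ goldphi * xx n + yy n - 1 := by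
    rw [hcc, ← mul_div_assoc, div_le_iff₀ hs]
    nlinarith
  have row3 : (1 - pp n) * cseq r (i+1) ≤ goldphi * (yy n - xx n - 1) + xx n + 1 := by
    rw [hcc, ← mul_div_assoc, div_le_iff₀ hs]
    have h3 : (goldphi * (yy n - xx n - 1) + xx n + 1) * (2 * goldphi - 1) =
        2 * qq n + goldphi * pp n + goldphi - 3 := by
      linear_combination goldphi * hy + (1 - goldphi) * hx + (qq n + pp n - 2) * hsq
    rw [h3]
    have : 0 < goldphi * pp n := mul_pos (by linarith) hp0
    linarith
  by_cases ha1 : a = 1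
  · subst ha1
    rw [Pi.smul_apply, smul_eq_mul, le_inv_mul_iff₀ hc]
    rw [Bexp_eq]
    simp [Aexp, wvec, Matrix.mulVec, dotProduct, Fin.sum_univ_succ]
    linarith
  by_cases ha2 : a = 2
  · subst ha2
    rw [Pi.smul_apply, smul_eq_mul, le_inv_mul_iff₀ hc]
    rw [Bexp_eq]
    simp [Aexp, wvec, Matrix.mulVec, dotProduct, Fin.sum_univ_succ]
    linarith
  have : wvec a = 0 := by
    revert ha1 ha2; fin_cases a <;> simp [wvec]
  rw [this, mul_zero]; exact hnn

theorem stmt3 (r : ℕ → ℕ) (hr : GoodSeq r) :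
    ∀ i : ℕ, 1 ≤ i → ∃ S : Matrix (Fin 9) (Fin 9) ℝ, S ≠ 0 ∧
      Tendsto
        (fun k => frobNorm (((List.range (k+1)).map (fun l => Rmat r (i + 2*l))).prod - S))
        atTop (nhds 0) := by
  intro i hi
  obtain ⟨j, rfl⟩ : ∃ j, i = j + 1 := ⟨i - 1, by omega⟩
  set X : ℕ → Matrix (Fin 9) (Fin 9) ℝ :=
    fun k => ((List.range k).map (fun l => Rmat r (j + 1 + 2*l))).prod with hXdef
  have hX : ∀ k, X (k+1) = X k * Rmat r (j + 1 + 2*k) := by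
    intro k; simp [hXdef, List.range_succ]
  obtain ⟨K, hK, hR⟩ := R_bound r
  have hθ0 : 0 ≤ 2 - goldphi := by linarith [gold_ub]
  obtain ⟨S, hS⟩ := prod_conv Lmat L_idem (fun k => Rmat r (j + 1 + 2*k)) K (2 - goldphi) hK
    hθ0 (by linarith [gold_lb]) (fun l => by
      refine (hR _).trans ?_
      gcongr
      have h1 := (rr_facts r hr (j + 2*l)).2
      have e1 : j + 1 + 2 * l = j + 2 * l + 1 := by ring
      rw [e1]
      show _ ≤ pp l
      have : pp (aseq r (j + 2 * l + 1 + 1)) ≤ pp (aseq r (j + 2 * l + 1) + l) :=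
        pp_anti (by have : j + 2 * l + 1 + 1 = j + 2 * l + 2 := rfl
                    rw [this]; omega)
      have hq := qq_pos (aseq r (j + 2 * l + 1))
      calc _ ≤ qq (aseq r (j + 2 * l + 1)) * pp (aseq r (j + 2 * l + 1) + l) := by gcongr
        _ = (qq (aseq r (j + 2 * l + 1)) * pp (aseq r (j + 2 * l + 1))) * pp l := by
          simp only [pp, pow_add]; ring
        _ = pp l := by rw [qp, one_mul]) X hX
  have hXnn : ∀ k a b, 0 ≤ X k a b := by
    intro k
    induction k with
    | zero => simpa [hXdef] using one_nn
    | succ k ih => rw [hX]; exact mul_nn ih (R_nn _ _)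
  have hlow : ∀ k, goldphi * (1/3 + 2/3 * (2/5)^k) ≤ (X k *ᵥ wvec) 1 := by
    intro k
    induction k with
    | zero => simp [hXdef, wvec]; norm_num
    | succ k ih =>
      have hmono : (1 - pp (aseq r (j + 1 + 2*k + 1))) * (X k *ᵥ wvec) 1
          ≤ (X (k+1) *ᵥ wvec) 1 := by
        rw [hX, ← Matrix.mulVec_mulVec]
        simp only [Matrix.mulVec, dotProduct, Finset.mul_sum]
        apply Finset.sum_le_sum
        intro b _
        have := Rw r (j + 1 + 2*k) b
        have h2 := mul_le_mul_of_nonneg_left this (hXnn k 1 b)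
        simp only [Matrix.mulVec, dotProduct, Finset.mul_sum] at h2 ⊢
        linarith
      have hp : pp (aseq r (j + 1 + 2*k + 1)) ≤ (2/5)^(k+1) := by
        refine (pp_anti ?_).trans (pp_le (k+1))
        have := (rr_facts r hr (j + 1 + 2*k)).1
        omega
      have ht1 : (2/5 : ℝ)^k ≤ 1 := pow_le_one₀ (by norm_num) (by norm_num)
      have ht0 : (0 : ℝ) < (2/5 : ℝ)^k := by positivity
      refine le_trans ?_ hmono
      have hg := gold_lb
      rw [pow_succ] at hp ⊢
      calc _ ≤ (1 - (2/5 : ℝ)^k * (2/5)) * (goldphi * (1/3 + 2/3 * (2/5)^k)) := by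
            have : (1/3 + 2/3 * ((2/5 : ℝ)^k * (2/5)))
              ≤ (1 - (2/5 : ℝ)^k * (2/5)) * (1/3 + 2/3 * (2/5)^k) := by nlinarith
            nlinarith
        _ ≤ (1 - pp (aseq r (j + 1 + 2*k + 1))) * (goldphi * (1/3 + 2/3 * (2/5)^k)) := by
            gcongr
        _ ≤ _ := by
            have := pp_le_one (aseq r (j + 1 + 2*k + 1))
            gcongr
  refine ⟨S, ?_, ?_⟩
  · rintro rfl
    have hc : Tendsto (fun k => (X k *ᵥ wvec) 1) atTop
        (nhds (((0 : Matrix (Fin 9) (Fin 9) ℝ) *ᵥ wvec) 1)) := by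
      have : Continuous (fun Y : Matrix (Fin 9) (Fin 9) ℝ => (Y *ᵥ wvec) 1) := by
        simp only [Matrix.mulVec, dotProduct]; fun_prop
      exact (this.tendsto 0).comp hS
    have := ge_of_tendsto' hc (b := goldphi / 3) (fun k => le_trans (by
      have := gold_lb
      have : (0 : ℝ) < (2/5 : ℝ)^k := by positivity
      nlinarith) (hlow k))
    simp at this
    linarith [gold_lb]
  · have hcont : Continuous (fun Y : Matrix (Fin 9) (Fin 9) ℝ => frobNorm (Y - S)) := by
      unfold frobNorm; simp only [Matrix.sub_apply]; fun_prop
    have h := (hcont.tendsto S).comp (hS.comp (tendsto_add_atTop_nat 1))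
    have h0 : frobNorm (S - S) = 0 := by simp [frobNorm]
    rw [h0] at h
    exact h
end

section
/- There exists a constant C > 0 such that ‖P_i − P̂_i‖_F ≤ C for every i ≥ 1. (The paper asserts that C = 10 works.) -/
open Filter Finset Matrix

/-- The matrix `P̂_i`. -/
noncomputable def Phat (r : ℕ → ℕ) (i : ℕ) : Matrix (Fin 9) (Fin 9) ℝ :=
  let ci := cseq r i
  let ci1 := cseq r (i+1)
  !![0,0,0,0,0,0,1,0,0;
     ci1 * ((Real.sqrt 5 - 1)/4), ci1 * (1/2), ci1 * ((1 + Real.sqrt 5)/4),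
       ci1 * ((3 + Real.sqrt 5)/4), ci1 * (1/2), 0, ci1 * ((3 + Real.sqrt 5)/4), 0, 0;
     ci1 * ((3 - Real.sqrt 5)/4), ci1 * ((Real.sqrt 5 - 1)/4), ci1 * (1/2),
       ci1 * ((1 + Real.sqrt 5)/4), ci1 * ((Real.sqrt 5 - 1)/4), 0,
       ci1 * ((1 + Real.sqrt 5)/4), 0, 0;
     0,0,0,0,0,0,0,0,1;
     0,1,0,1,1,0,0,0,0;
     1,0,1,0,0,0,0,0,0;
     0,0,0,0,0,1,0,1,0;
     ci * ((1 + Real.sqrt 5)/4), ci * ((1 + Real.sqrt 5)/4), ci * ((1 + Real.sqrt 5)/4),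
       ci * ((Real.sqrt 5 - 1)/4), ci * ((Real.sqrt 5 - 1)/4), ci * ((3 - Real.sqrt 5)/4),
       0, ci * (1/2), ci * ((Real.sqrt 5 - 1)/4);
     ci * ((3 + Real.sqrt 5)/4), ci * ((3 + Real.sqrt 5)/4), ci * ((3 + Real.sqrt 5)/4),
       ci * (1/2), ci * (1/2), ci * ((Real.sqrt 5 - 1)/4), 0,
       ci * ((1 + Real.sqrt 5)/4), ci * (1/2)]

/-- Closed form of `A^n`. -/
def Emat (p q : ℝ) : Matrix (Fin 9) (Fin 9) ℝ :=
  !![1,0,0,0,0,0,0,0,0;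
     0,1,0,0,0,0,0,0,0;
     0,0,1,0,0,0,0,0,0;
     0,0,0,1,0,0,0,0,0;
     0,0,0,0,1,0,0,0,0;
     0,0,0,0,0,1,0,0,0;
     0,0,0,0,0,0,1,0,0;
     0,0,0,p-1,p-1,p+q-1,q-p+1,p,q;
     0,0,0,q,q,p+2*q-1,p-1,q,p+q]

/-- `A^n M`. -/
def EMmat (p q : ℝ) : Matrix (Fin 9) (Fin 9) ℝ :=
  !![0,0,0,0,0,1,0,0,0;
     0,0,0,0,0,0,0,0,1;
     0,0,0,0,0,0,0,1,0;
     0,1,0,0,0,0,0,0,0;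
     0,0,0,1,1,0,0,0,0;
     0,0,0,0,0,0,1,0,0;
     1,0,1,0,0,0,0,0,0;
     q-p+1,p-1,q+1,p+q-1,p-1,0,p+q-1,0,0;
     p-1,q,p+q-1,p+2*q,q,0,p+2*q-1,0,0]

/-- `A^m M A^n M`. -/
def PEmat (p q p' q' : ℝ) : Matrix (Fin 9) (Fin 9) ℝ :=
  !![0,0,0,0,0,0,1,0,0;
     p'-1,q',p'+q'-1,p'+2*q',q',0,p'+2*q'-1,0,0;
     q'-p'+1,p'-1,q'+1,p'+q'-1,p'-1,0,p'+q'-1,0,0;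
     0,0,0,0,0,0,0,0,1;
     0,1,0,1,1,0,0,0,0;
     1,0,1,0,0,0,0,0,0;
     0,0,0,0,0,1,0,1,0;
     p+q-1,p+q-1,p+q-1,p-1,p-1,q-p+1,0,q+1,p-1;
     p+2*q-1,p+2*q,p+2*q-1,q,q,p-1,0,p+q-1,q]

lemma Emat_zero : Emat 1 0 = 1 := by
  ext i j
  fin_cases i <;> fin_cases j <;> simp [Emat, Matrix.one_apply]

set_option maxHeartbeats 4000000 in
lemma Emat_mul (p q : ℝ) : Emat p q * Amat = Emat (p + q) (p + 2 * q) := by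
  ext i j
  rw [Matrix.mul_apply]
  fin_cases i <;> fin_cases j <;> simp [Emat, Amat, Fin.sum_univ_succ] <;> ring

set_option maxHeartbeats 4000000 in
lemma Emat_mul_M (p q : ℝ) : Emat p q * Mmat = EMmat p q := by
  ext i j
  rw [Matrix.mul_apply]
  fin_cases i <;> fin_cases j <;> simp [Emat, Mmat, EMmat, Fin.sum_univ_succ] <;> ring

set_option maxHeartbeats 4000000 in
lemma EMmat_mul (p q p' q' : ℝ) : EMmat p q * EMmat p' q' = PEmat p q p' q' := by
  ext i j
  rw [Matrix.mul_apply]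
  fin_cases i <;> fin_cases j <;> simp [PEmat, EMmat, Fin.sum_univ_succ] <;> ring

lemma Apow_aux (n : ℕ) : ∃ d e : ℝ, 0 ≤ d ∧ d ≤ 1 ∧ e = - d * ((Real.sqrt 5 - 1) / 2) ∧
    Amat ^ n = Emat (((2 / Real.sqrt 5) * goldphi ^ (2 * n)) * ((Real.sqrt 5 - 1) / 4) + d)
      (((2 / Real.sqrt 5) * goldphi ^ (2 * n)) * (1 / 2) + e) := by
  have h5 : Real.sqrt 5 * Real.sqrt 5 = 5 := Real.mul_self_sqrt (by norm_num)
  have h0 : 0 < Real.sqrt 5 := Real.sqrt_pos.mpr (by norm_num)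
  have h2 : 2 < Real.sqrt 5 := by nlinarith
  have h3 : Real.sqrt 5 < 3 := by nlinarith
  have hinv : 2 / Real.sqrt 5 = 2 * Real.sqrt 5 / 5 := by
    field_simp
    nlinarith
  induction n with
  | zero =>
    refine ⟨(5 + Real.sqrt 5) / 10, -Real.sqrt 5 / 5, by positivity, by linarith,
      by linear_combination (1 / 20 : ℝ) * h5, ?_⟩
    rw [pow_zero, ← Emat_zero, hinv]
    congr 1
    · simp only [mul_zero, pow_zero]
      linear_combination (-1 / 10 : ℝ) * h5
    · simp only [mul_zero, pow_zero]
      ring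
  | succ n ih =>
    obtain ⟨d, e, hd0, hd1, he, hA⟩ := ih
    refine ⟨d + e, d + 2 * e, ?_, ?_, ?_, ?_⟩
    · rw [he]; nlinarith
    · rw [he]; nlinarith
    · rw [he]; linear_combination (-d / 4) * h5
    · rw [pow_succ, hA, Emat_mul]
      have hg : goldphi ^ (2 * (n + 1)) = goldphi ^ (2 * n) * ((3 + Real.sqrt 5) / 2) := by
        rw [mul_add, pow_add]
        congr 1
        unfold goldphi
        linear_combination (1 / 4 : ℝ) * h5
      rw [hg]
      generalize (2 / Real.sqrt 5) = k
      generalize goldphi ^ (2 * n) = x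
      congr 1
      · linear_combination (-k * x / 8) * h5
      · ring

lemma Apow_s6 (r : ℕ → ℕ) (i : ℕ) : ∃ d e : ℝ, |d| ≤ 1 ∧ |e| ≤ 1 ∧
    Amat ^ (aseq r i) = Emat (cseq r i * ((Real.sqrt 5 - 1) / 4) + d)
      (cseq r i * (1 / 2) + e) := by
  obtain ⟨d, e, h0, h1, he, hA⟩ := Apow_aux (aseq r i)
  have h5 : Real.sqrt 5 * Real.sqrt 5 = 5 := Real.mul_self_sqrt (by norm_num)
  have hp : 0 < Real.sqrt 5 := Real.sqrt_pos.mpr (by norm_num)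
  have h2 : 2 < Real.sqrt 5 := by nlinarith
  have h3 : Real.sqrt 5 < 3 := by nlinarith
  refine ⟨d, e, abs_le.mpr ⟨by linarith, h1⟩, abs_le.mpr ⟨?_, ?_⟩, hA⟩
  · rw [he]; nlinarith
  · rw [he]; nlinarith

set_option maxHeartbeats 4000000 in
lemma entry_bound_s6 (r : ℕ → ℕ) (i : ℕ) (a b : Fin 9) : |(Pmat r i - Phat r i) a b| ≤ 10 := by
  obtain ⟨d, e, hd, he, hA⟩ := Apow_s6 r i
  obtain ⟨d', e', hd', he', hA'⟩ := Apow_s6 r (i + 1)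
  rw [abs_le] at hd he hd' he'
  obtain ⟨hd1, hd2⟩ := hd
  obtain ⟨he1, he2⟩ := he
  obtain ⟨hd1', hd2'⟩ := hd'
  obtain ⟨he1', he2'⟩ := he'
  have hP : Pmat r i = PEmat (cseq r i * ((Real.sqrt 5 - 1) / 4) + d) (cseq r i * (1 / 2) + e)
      (cseq r (i + 1) * ((Real.sqrt 5 - 1) / 4) + d') (cseq r (i + 1) * (1 / 2) + e') := by
    rw [Pmat, hA, hA', Emat_mul_M, Matrix.mul_assoc, Emat_mul_M, EMmat_mul]
  rw [hP, Matrix.sub_apply]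
  unfold Phat
  generalize cseq r i = c
  generalize cseq r (i + 1) = c'
  generalize Real.sqrt 5 = s
  rw [abs_le]
  fin_cases a <;> fin_cases b <;> simp [PEmat] <;> constructor <;> linarith

/-- `‖P_i − P̂_i‖_F` is uniformly bounded over `i ≥ 1`. -/
theorem stmt6 (r : ℕ → ℕ) (hr : GoodSeq r) :
    ∃ C : ℝ, 0 < C ∧ ∀ i : ℕ, 1 ≤ i → frobNorm (Pmat r i - Phat r i) ≤ C := by
  refine ⟨90, by norm_num, fun i _ => ?_⟩
  unfold frobNorm
  rw [Real.sqrt_le_left (by norm_num)]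
  calc ∑ a, ∑ b, ((Pmat r i - Phat r i) a b) ^ 2 ≤ ∑ a : Fin 9, ∑ b : Fin 9, (10 : ℝ) ^ 2 := by
        refine Finset.sum_le_sum fun a _ => Finset.sum_le_sum fun b _ => ?_
        exact sq_le_sq' (abs_le.mp (entry_bound_s6 r i a b)).1 (abs_le.mp (entry_bound_s6 r i a b)).2
    _ ≤ 90 ^ 2 := by norm_num
end
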